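/- The series ∑_{n=0}^∞ ((1/2)_n (1/4)_n (3/4)_n)/((1)_n^3) · (20n+3) · (-1/4)^n equals 8/π. -/

import Mathlib

open Real

noncomputable def poch (a : ℝ) (n : ℕ) : ℝ := (ascPochhammer ℝ n).eval a

open Filter Topology

noncomputable def wz_w : ℕ → ℝ
  | 0 => 1
  | m + 1 => wz_w m * ((2 * (m:ℝ) + 1) / (2 * (m:ℝ) + 2)) ^ 2

noncomputable def wz_B (n m : ℕ) : ℝ :=
  -((2 * (n:ℝ) + 1) / (2 * ((n:ℝ) + 1)) * ((2 * (n:ℝ) + 2 * m + 1) / (2 * ((n:ℝ) + m + 1)))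
    * ((4 * (n:ℝ) + 1) / (2 * (2 * (n:ℝ) + 1 + m)))
    * ((4 * (n:ℝ) + 3) / (2 * (2 * (n:ℝ) + 2 + m)))) / 4

noncomputable def wz_K : ℕ → ℕ → ℝ
  | 0, m => wz_w m
  | n + 1, m => wz_K n m * wz_B n m

noncomputable def wz_P (n m : ℝ) : ℝ := 40*n^2+32*n*m+26*n+8*m^2+10*m+3

noncomputable def wz_G (n m : ℕ) : ℝ := wz_K n m * (wz_P n m / (8 * (2 * (n:ℝ) + 1 + m)))

lemma wz_K_step (n m : ℕ) : wz_K n (m+1) = wz_K n m *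
    (((2 * (m:ℝ) + 2 * n + 1) * (2 * m + 1)) / (4 * (1 + (m:ℝ) + n) * (1 + m + 2 * n))) := by
  induction n with
  | zero =>
    simp only [wz_K, wz_w]
    have : (1 + (m:ℝ)) ≠ 0 := by positivity
    have : (2 * (m:ℝ) + 2) ≠ 0 := by positivity
    push_cast
    field_simp
    ring
  | succ n ih =>
    simp only [wz_K]
    rw [ih, mul_assoc, mul_assoc (wz_K n m) (wz_B n m)]
    refine congrArg (fun t => wz_K n m * t) ?_
    unfold wz_B
    push_cast
    have h1 : ((n:ℝ) + 1) ≠ 0 := by positivity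
    have h2 : ((n:ℝ) + m + 1) ≠ 0 := by positivity
    have h3 : (2 * (n:ℝ) + 1 + m) ≠ 0 := by positivity
    have h4 : (2 * (n:ℝ) + 2 + m) ≠ 0 := by positivity
    have h5 : (1 + (m:ℝ) + n) ≠ 0 := by positivity
    have h6 : (1 + (m:ℝ) + 2 * n) ≠ 0 := by positivity
    have h7 : ((n:ℝ) + (m + 1) + 1) ≠ 0 := by positivity
    have h8 : (2 * (n:ℝ) + 1 + (m + 1)) ≠ 0 := by positivity
    have h9 : (2 * (n:ℝ) + 2 + (m + 1)) ≠ 0 := by positivity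
    have h10 : (1 + (m:ℝ) + (n + 1)) ≠ 0 := by positivity
    have h11 : (1 + (m:ℝ) + 2 * (n + 1)) ≠ 0 := by positivity
    field_simp
    ring

lemma wz_cert (n m : ℕ) : wz_G n (m+1) - wz_G n m =
    2 * ((n+1:ℕ):ℝ) * wz_K (n+1) m - 2 * (n:ℝ) * wz_K n m := by
  unfold wz_G
  rw [wz_K_step]
  simp only [wz_K]
  unfold wz_B wz_P
  push_cast
  have h1 : ((n:ℝ) + 1) ≠ 0 := by positivity
  have h2 : ((n:ℝ) + m + 1) ≠ 0 := by positivity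
  have h3 : (2 * (n:ℝ) + 1 + m) ≠ 0 := by positivity
  have h4 : (2 * (n:ℝ) + 2 + m) ≠ 0 := by positivity
  have h5 : (1 + (m:ℝ) + n) ≠ 0 := by positivity
  have h6 : (1 + (m:ℝ) + 2 * n) ≠ 0 := by positivity
  have h8 : (2 * (n:ℝ) + 1 + (m + 1)) ≠ 0 := by positivity
  have e5 : (1 + (m:ℝ) + n) = n + m + 1 := by ring
  have e6 : (1 + (m:ℝ) + 2 * n) = 2 * n + 1 + m := by ring
  have e8 : (2 * (n:ℝ) + 1 + (m + 1)) = 2 * n + 2 + m := by ring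
  rw [e5, e6, e8]
  field_simp
  ring

lemma wz_w_pos (m : ℕ) : 0 < wz_w m := by
  induction m with
  | zero => simp [wz_w]
  | succ m ih => simp only [wz_w]; positivity

lemma wz_w_le (m : ℕ) : wz_w m * (m + 1) ≤ 1 := by
  induction m with
  | zero => simp [wz_w]
  | succ m ih =>
    refine le_trans ?_ ih
    simp only [wz_w]
    rw [mul_assoc]
    apply mul_le_mul_of_nonneg_left _ (wz_w_pos m).le
    push_cast
    rw [div_pow, div_mul_eq_mul_div, div_le_iff₀ (by positivity)]
    have : (0:ℝ) ≤ m := by positivity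
    nlinarith [this]

lemma wz_B_abs (n m : ℕ) : |wz_B n m| ≤ 1/4 * ((4 * (n:ℝ) + 1) / (2 * (2 * (n:ℝ) + 1 + m))) := by
  unfold wz_B
  rw [abs_div, abs_neg, abs_of_nonneg (by positivity), abs_of_nonneg (by norm_num : (0:ℝ) ≤ 4)]
  have hn : (0:ℝ) ≤ n := by positivity
  have hm : (0:ℝ) ≤ m := by positivity
  have a1 : (2 * (n:ℝ) + 1) / (2 * ((n:ℝ) + 1)) ≤ 1 := by
    rw [div_le_one (by positivity)]; linarith
  have a2 : (2 * (n:ℝ) + 2 * m + 1) / (2 * ((n:ℝ) + m + 1)) ≤ 1 := by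
    rw [div_le_one (by positivity)]; linarith
  have a4 : (4 * (n:ℝ) + 3) / (2 * (2 * (n:ℝ) + 2 + m)) ≤ 1 := by
    rw [div_le_one (by positivity)]; linarith
  have p3 : 0 ≤ (4 * (n:ℝ) + 1) / (2 * (2 * (n:ℝ) + 1 + m)) := by positivity
  have a12 := mul_le_one₀ a1 (by positivity) a2
  have a123 := mul_le_mul_of_nonneg_right a12 p3
  have := mul_le_mul a123 a4 (by positivity) (by positivity)
  linarith

lemma wz_B_abs' (n m : ℕ) : |wz_B n m| ≤ 1/4 := by
  refine (wz_B_abs n m).trans ?_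
  have hm : (0:ℝ) ≤ m := by positivity
  have : (4 * (n:ℝ) + 1) / (2 * (2 * (n:ℝ) + 1 + m)) ≤ 1 := by
    rw [div_le_one (by positivity)]; linarith
  linarith

lemma wz_K_abs (n m : ℕ) : |wz_K n m| ≤ wz_w m * (1/4)^n := by
  induction n with
  | zero => simp [wz_K, abs_of_pos (wz_w_pos m)]
  | succ n ih =>
    simp only [wz_K]
    rw [abs_mul, pow_succ, ← mul_assoc]
    exact mul_le_mul ih (wz_B_abs' n m) (abs_nonneg _) (by have := wz_w_pos m; positivity)

lemma wz_G_abs (n m : ℕ) : |wz_G n m| ≤ |wz_K n m| * ((3 * n + 1) * (m + 1)) := by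
  unfold wz_G
  rw [abs_mul]
  apply mul_le_mul_of_nonneg_left _ (abs_nonneg _)
  unfold wz_P
  rw [abs_of_nonneg (by positivity), div_le_iff₀ (by positivity)]
  have hn : (0:ℝ) ≤ n := by positivity
  have hm : (0:ℝ) ≤ m := by positivity
  nlinarith [mul_nonneg hn hm, mul_nonneg hn (mul_nonneg hn hm), mul_nonneg hn (mul_nonneg hm hm)]

lemma wz_G_bd (n m : ℕ) : |wz_G n m| ≤ (3 * n + 1) * (1/4)^n := by
  refine (wz_G_abs n m).trans ?_
  calc _ ≤ (wz_w m * (1/4)^n) * ((3 * n + 1) * (m + 1)) :=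
        mul_le_mul_of_nonneg_right (wz_K_abs n m) (by positivity)
    _ = (wz_w m * (m + 1)) * ((3 * n + 1) * (1/4)^n) := by ring
    _ ≤ 1 * ((3 * n + 1) * (1/4)^n) :=
        mul_le_mul_of_nonneg_right (wz_w_le m) (by positivity)
    _ = _ := one_mul _

lemma wz_bd_summable : Summable (fun n : ℕ => (3 * (n:ℝ) + 1) * (1/4)^n) := by
  have h1 : Summable (fun n : ℕ => (n:ℝ)^1 * (1/4:ℝ)^n) :=
    summable_pow_mul_geometric_of_norm_lt_one 1 (by norm_num)
  have h2 : Summable (fun n : ℕ => (1/4:ℝ)^n) :=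
    summable_geometric_of_lt_one (by norm_num) (by norm_num)
  refine ((h1.mul_left 3).add h2).congr fun n => ?_
  ring

lemma wz_G_summable (m : ℕ) : Summable (fun n => wz_G n m) :=
  Summable.of_norm_bounded wz_bd_summable (fun n => by simpa using wz_G_bd n m)

lemma wz_F_tendsto (m : ℕ) : Tendsto (fun n : ℕ => 2 * (n:ℝ) * wz_K n m) atTop (𝓝 0) := by
  refine squeeze_zero_norm (fun n => ?_) wz_bd_summable.tendsto_atTop_zero
  rw [Real.norm_eq_abs, abs_mul, abs_of_nonneg (by positivity : (0:ℝ) ≤ 2 * (n:ℝ))]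
  have h1 := wz_K_abs n m
  have h2 : wz_w m ≤ 1 := by
    have := wz_w_le m
    have := wz_w_pos m
    have hm : (0:ℝ) ≤ m := by positivity
    nlinarith
  have hp : (0:ℝ) < (1/4)^n := by positivity
  have h3 : |wz_K n m| ≤ (1/4)^n := h1.trans (by nlinarith)
  exact mul_le_mul (by linarith [(by positivity : (0:ℝ) ≤ n)]) h3 (abs_nonneg _) (by positivity)

lemma wz_const_step (m : ℕ) : ∑' n, wz_G n (m+1) = ∑' n, wz_G n m := by
  rw [← sub_eq_zero, ← (wz_G_summable (m+1)).tsum_sub (wz_G_summable m)]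
  have hs := ((wz_G_summable (m+1)).sub (wz_G_summable m)).hasSum.tendsto_sum_nat
  refine tendsto_nhds_unique hs ?_
  have : (fun N : ℕ => ∑ i ∈ Finset.range N, (wz_G i (m+1) - wz_G i m)) =
      fun N : ℕ => 2 * (N:ℝ) * wz_K N m := by
    funext N
    rw [Finset.sum_congr rfl (fun i _ => wz_cert i m),
      Finset.sum_range_sub (fun i : ℕ => 2 * (i:ℝ) * wz_K i m)]
    simp
  rw [this]
  exact wz_F_tendsto m

lemma wz_const (m : ℕ) : ∑' n, wz_G n m = ∑' n, wz_G n 0 := by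
  induction m with
  | zero => rfl
  | succ m ih => rw [wz_const_step, ih]

lemma wz_wallis (m : ℕ) : wz_w m * (2 * m + 1) = (Real.Wallis.W m)⁻¹ := by
  induction m with
  | zero => simp [wz_w, Real.Wallis.W]
  | succ m ih =>
    rw [Real.Wallis.W_succ, mul_inv, ← ih]
    simp only [wz_w]
    push_cast
    have : (2 * (m:ℝ) + 1) ≠ 0 := by positivity
    have : (2 * (m:ℝ) + 2) ≠ 0 := by positivity
    have : (2 * (m:ℝ) + 3) ≠ 0 := by positivity
    field_simp
    ring

lemma wz_inv_tendsto : Tendsto (fun m : ℕ => 1 / ((m:ℝ) + 1)) atTop (𝓝 0) :=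
  tendsto_one_div_add_atTop_nhds_zero_nat

lemma wz_G_zero_tendsto : Tendsto (fun m : ℕ => wz_G 0 m) atTop (𝓝 (1/π)) := by
  have h1 : (fun m : ℕ => wz_G 0 m) =
      fun m : ℕ => (Real.Wallis.W m)⁻¹ * (1/2 - 1/8 * (1 / ((m:ℝ) + 1))) := by
    funext m
    rw [← wz_wallis]
    unfold wz_G wz_P
    simp only [wz_K]
    push_cast
    have : ((m:ℝ) + 1) ≠ 0 := by positivity
    have : (2 * (0:ℝ) + 1 + m) ≠ 0 := by positivity
    have : (1 + (m:ℝ)) ≠ 0 := by positivity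
    field_simp
    ring
  rw [h1]
  have h2 := (Real.Wallis.tendsto_W_nhds_pi_div_two.inv₀ (by positivity)).mul
    ((wz_inv_tendsto.const_mul (1/8)).const_sub (1/2))
  convert h2 using 2
  field_simp
  norm_num

lemma wz_G_succ_tendsto (n : ℕ) : Tendsto (fun m : ℕ => wz_G (n+1) m) atTop (𝓝 0) := by
  have h := wz_inv_tendsto.const_mul ((3 * ((n+1:ℕ):ℝ) + 1) * (4 * (n:ℝ) + 1))
  rw [mul_zero] at h
  refine squeeze_zero_norm (fun m => ?_) h
  rw [Real.norm_eq_abs]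
  refine (wz_G_abs (n+1) m).trans ?_
  have hK : |wz_K (n+1) m| ≤ wz_w m * ((4 * (n:ℝ) + 1) * (1 / ((m:ℝ) + 1))) := by
    simp only [wz_K]
    rw [abs_mul]
    have h1 : |wz_K n m| ≤ wz_w m := (wz_K_abs n m).trans
      (mul_le_of_le_one_right (wz_w_pos m).le (pow_le_one₀ (by norm_num) (by norm_num)))
    refine mul_le_mul h1 ((wz_B_abs n m).trans ?_) (abs_nonneg _) (wz_w_pos m).le
    rw [mul_one_div, ← mul_div_assoc]
    have hn : (0:ℝ) ≤ n := by positivity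
    have hm : (0:ℝ) ≤ m := by positivity
    exact div_le_div₀ (by positivity) (by linarith) (by positivity) (by linarith)
  calc _ ≤ wz_w m * ((4 * (n:ℝ) + 1) * (1 / ((m:ℝ) + 1))) * ((3 * ((n+1:ℕ):ℝ) + 1) * (m + 1)) :=
        mul_le_mul_of_nonneg_right hK (by positivity)
    _ = (wz_w m * (m+1)) * ((3 * ((n+1:ℕ):ℝ) + 1) * (4 * (n:ℝ) + 1) * (1 / ((m:ℝ) + 1))) := by ring
    _ ≤ 1 * ((3 * ((n+1:ℕ):ℝ) + 1) * (4 * (n:ℝ) + 1) * (1 / ((m:ℝ) + 1))) :=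
        mul_le_mul_of_nonneg_right (wz_w_le m) (by positivity)
    _ = _ := one_mul _

lemma wz_total : ∑' n, wz_G n 0 = 1/π := by
  have h : Tendsto (fun m : ℕ => ∑' n, wz_G n m) atTop
      (𝓝 (∑' n : ℕ, if n = 0 then 1/π else 0)) := by
    refine tendsto_tsum_of_dominated_convergence wz_bd_summable (fun n => ?_)
      (Eventually.of_forall fun m n => by simpa using wz_G_bd n m)
    cases n with
    | zero => simpa using wz_G_zero_tendsto
    | succ n => simpa using wz_G_succ_tendsto n
  rw [tsum_ite_eq] at h
  simp only [wz_const] at h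
  exact tendsto_nhds_unique tendsto_const_nhds h

lemma wz_poch_succ (a : ℝ) (n : ℕ) : poch a (n+1) = poch a n * (a + n) := by
  simp [poch, ascPochhammer_succ_right]

lemma wz_poch_one_pos (n : ℕ) : 0 < poch 1 n := by
  induction n with
  | zero => simp [poch]
  | succ n ih => rw [wz_poch_succ]; positivity

lemma wz_K_zero (n : ℕ) : wz_K n 0 =
    (poch (1/2) n * poch (1/4) n * poch (3/4) n) / (poch 1 n)^3 * ((-1:ℝ)/4)^n := by
  induction n with
  | zero => simp [wz_K, wz_w, poch]
  | succ n ih =>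
    simp only [wz_K]
    rw [ih]
    simp only [wz_poch_succ, pow_succ]
    unfold wz_B
    have := (wz_poch_one_pos n).ne'
    have h1 : ((n:ℝ) + 1) ≠ 0 := by positivity
    have h2 : (1 + (n:ℝ)) ≠ 0 := by positivity
    have h3 : (2 * (n:ℝ) + 1) ≠ 0 := by positivity
    have h4 : (2 * (n:ℝ) + 2) ≠ 0 := by positivity
    push_cast
    simp only [mul_zero, add_zero]
    field_simp
    ring

theorem stmt_12 :
    ∑' n : ℕ, (poch (1/2) n * poch (1/4) n * poch (3/4) n) / (poch 1 n)^3 * (20*(n:ℝ)+3) * ((-1:ℝ)/4)^n = 8 / π := by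
  have h : ∀ n : ℕ, (poch (1/2) n * poch (1/4) n * poch (3/4) n) / (poch 1 n)^3 * (20*(n:ℝ)+3) * ((-1:ℝ)/4)^n = 8 * wz_G n 0 := by
    intro n
    unfold wz_G wz_P
    rw [wz_K_zero]
    have h3 : (2 * (n:ℝ) + 1) ≠ 0 := by positivity
    have := (wz_poch_one_pos n).ne'
    push_cast
    simp only [mul_zero, add_zero]
    field_simp
    ring
  rw [tsum_congr h, tsum_mul_left, wz_total]
  ring
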